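/- Let f ∈ L_n^d be a Lorentzian polynomial and set c_d = max over all α, β, γ ∈ ℕ^n with |α| ≤ d and β + γ = α of 2^{|β||γ|}·((d−|β|)!·(d−|γ|)!)/(d!·(d−|α|)!). Then for all x, y, z ∈ ℝ^n with nonnegative coordinates, f(x)·f(x+y+z) ≤ c_d · f(x+y)·f(x+z). -/

import Mathlib

open MvPolynomial

namespace LorentzianPaper

/-- Iterated partial derivative `∂^α f`. -/
noncomputable def pd {n : ℕ} (α : Fin n → ℕ) (f : MvPolynomial (Fin n) ℝ) :
    MvPolynomial (Fin n) ℝ :=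
  (List.finRange n).foldr (fun i g => (fun h => pderiv i h)^[α i] g) f

/-- Hessian matrix of `f` at `x`. -/
noncomputable def hess {n : ℕ} (f : MvPolynomial (Fin n) ℝ) (x : Fin n → ℝ) :
    Matrix (Fin n) (Fin n) ℝ :=
  Matrix.of fun i j => eval x (pderiv i (pderiv j f))

/-- Number of positive eigenvalues (with multiplicity) of a real symmetric matrix. -/
noncomputable def posEigCount {n : ℕ} (M : Matrix (Fin n) (Fin n) ℝ) : ℕ :=
  if h : M.IsHermitian then {i | 0 < h.eigenvalues i}.ncard else 0

/-- Homogeneous polynomials of degree `d` with all coefficients positive. -/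
def PPos (n d : ℕ) : Set (MvPolynomial (Fin n) ℝ) :=
  {f | f.IsHomogeneous d ∧ ∀ α : Fin n →₀ ℕ, (∑ i, α i) = d → 0 < f.coeff α}

/-- Strictly Lorentzian quadratics. -/
def StrictLor2 (n : ℕ) : Set (MvPolynomial (Fin n) ℝ) :=
  {f | f ∈ PPos n 2 ∧ IsUnit (hess f 0).det ∧ posEigCount (hess f 0) = 1}

/-- Strictly Lorentzian polynomials. -/
def StrictLor (n d : ℕ) : Set (MvPolynomial (Fin n) ℝ) :=
  if d ≤ 1 then PPos n d
  else {f | f ∈ PPos n d ∧ ∀ α : Fin n → ℕ, (∑ i, α i) = d - 2 → pd α f ∈ StrictLor2 n}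

noncomputable def coeffFun {n : ℕ} (f : MvPolynomial (Fin n) ℝ) : (Fin n →₀ ℕ) → ℝ :=
  fun α => f.coeff α

/-- Lorentzian polynomials: closure of the strictly Lorentzian ones in `H_n^d`. -/
def Lor (n d : ℕ) : Set (MvPolynomial (Fin n) ℝ) :=
  {f | f.IsHomogeneous d ∧ coeffFun f ∈ closure (coeffFun '' StrictLor n d)}

/-- `c`-Rayleigh polynomials. -/
def IsRayleigh {n : ℕ} (c : ℝ) (f : MvPolynomial (Fin n) ℝ) : Prop :=
  (∀ α, 0 ≤ f.coeff α) ∧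
  ∀ (α : Fin n → ℕ) (i j : Fin n) (x : Fin n → ℝ), (∀ t, 0 ≤ x t) →
    eval x (pd α f) * eval x (pd (α + Pi.single i 1 + Pi.single j 1) f) ≤
      c * eval x (pd (α + Pi.single i 1) f) * eval x (pd (α + Pi.single j 1) f)

/-- The constant `c_d`: the maximum of
`2^{bg}·((d-b)!(d-g)!)/(d!(d-b-g)!)` over all `b, g ≥ 0` with `b + g ≤ d`. -/
noncomputable def cD (d : ℕ) : ℝ :=
  (((Finset.range (d + 1)) ×ˢ (Finset.range (d + 1))).filter
      (fun p => p.1 + p.2 ≤ d)).sup'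
    (⟨(0, 0), by simp⟩)
    (fun p => 2 ^ (p.1 * p.2) *
      (((d - p.1).factorial * (d - p.2).factorial : ℕ) : ℝ) /
      ((d.factorial * (d - p.1 - p.2).factorial : ℕ) : ℝ))

/-- Reverse Cauchy-Schwarz for a matrix. -/
def RCS {n : ℕ} (M : Matrix (Fin n) (Fin n) ℝ) : Prop :=
  ∀ u v : Fin n → ℝ, 0 < u ⬝ᵥ M.mulVec u →
    (u ⬝ᵥ M.mulVec u) * (v ⬝ᵥ M.mulVec v) ≤ (u ⬝ᵥ M.mulVec v) ^ 2

theorem symm_dot {n : ℕ} {M : Matrix (Fin n) (Fin n) ℝ} (hM : M.IsHermitian)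
    (u v : Fin n → ℝ) : u ⬝ᵥ M.mulVec v = M.mulVec u ⬝ᵥ v := by
  rw [Matrix.dotProduct_mulVec, ← Matrix.mulVec_transpose]
  have : M.transpose = M := by
    have h := hM.eq
    rwa [Matrix.conjTranspose_eq_transpose_of_trivial] at h
  rw [this]

theorem RCS_of_functional {n : ℕ} {M : Matrix (Fin n) (Fin n) ℝ} (hM : M.IsHermitian)
    (l : Fin n → ℝ) (h : ∀ p, l ⬝ᵥ p = 0 → p ⬝ᵥ M.mulVec p ≤ 0) : RCS M := by
  intro u v hu
  set a := l ⬝ᵥ u with ha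
  set b := l ⬝ᵥ v with hb
  have ha0 : a ≠ 0 := by
    intro h0
    exact absurd (h u h0) (not_le.mpr hu)
  have h1 := h (b • u - a • v) (by simp [dotProduct_sub, dotProduct_smul, ← ha, ← hb]; ring)
  have hvu : v ⬝ᵥ M.mulVec u = u ⬝ᵥ M.mulVec v := by
    rw [symm_dot hM v u, dotProduct_comm]
  simp only [Matrix.mulVec_sub, Matrix.mulVec_smul, dotProduct_sub, sub_dotProduct, dotProduct_smul,
    smul_dotProduct, smul_eq_mul, hvu] at h1
  set A := u ⬝ᵥ M.mulVec u
  set B := u ⬝ᵥ M.mulVec v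
  set C := v ⬝ᵥ M.mulVec v
  have h2 : 0 < a ^ 2 := by positivity
  have h3 : a ^ 2 * (A * C) ≤ a ^ 2 * B ^ 2 := by
    nlinarith [mul_le_mul_of_nonneg_left h1 hu.le, sq_nonneg (b * A - a * B)]
  exact le_of_mul_le_mul_left h3 h2

theorem spectral_sum {n : ℕ} {M : Matrix (Fin n) (Fin n) ℝ} (hM : M.IsHermitian)
    (p : Fin n → ℝ) : p ⬝ᵥ M.mulVec p =
      ∑ i, hM.eigenvalues i * ((hM.eigenvectorBasis i : Fin n → ℝ) ⬝ᵥ p) ^ 2 := by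
  have h := hM.eigenvectorBasis.sum_inner_mul_inner (WithLp.toLp 2 p) (WithLp.toLp 2 (M.mulVec p))
  simp only [EuclideanSpace.inner_eq_star_dotProduct, star_trivial] at h
  rw [dotProduct_comm, ← h]
  refine Finset.sum_congr rfl fun i _ => ?_
  rw [dotProduct_comm (M.mulVec p), symm_dot hM, hM.mulVec_eigenvectorBasis, smul_dotProduct, smul_eq_mul]
  ring

theorem RCS_of_posEig {n : ℕ} {M : Matrix (Fin n) (Fin n) ℝ} (h : posEigCount M = 1) : RCS M := by
  unfold posEigCount at h
  split_ifs at h with hM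
  obtain ⟨i0, hi0⟩ := Set.ncard_eq_one.mp h
  refine RCS_of_functional hM (hM.eigenvectorBasis i0) fun p hp => ?_
  rw [spectral_sum hM]
  refine Finset.sum_nonpos fun i _ => ?_
  by_cases hi : i = i0
  · subst hi; rw [hp]; simp
  · have : ¬ 0 < hM.eigenvalues i := fun hpos => hi (by
      have : i ∈ ({i | 0 < hM.eigenvalues i} : Set (Fin n)) := hpos
      rw [hi0] at this; exact this)
    exact mul_nonpos_of_nonpos_of_nonneg (not_lt.mp this) (sq_nonneg _)

theorem perron_ident {n : ℕ} (A : Fin n → Fin n → ℝ) (hs : ∀ i j, A i j = A j i)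
    (w v : Fin n → ℝ) (hw : ∀ i, 0 < w i) :
    ∑ i, ∑ j, A i j * w i * w j * (v i / w i - v j / w j) ^ 2 =
      2 * (∑ i, (∑ j, A i j * w j) / w i * v i ^ 2 - ∑ i, v i * ∑ j, A i j * v j) := by
  have h1 : ∀ i j, A i j * w i * w j * (v i / w i - v j / w j) ^ 2 =
      A i j * w j / w i * v i ^ 2 + A j i * w i / w j * v j ^ 2 - 2 * (v i * (A i j * v j)) := by
    intro i j
    have := (hw i).ne'
    have := (hw j).ne'
    rw [← hs i j]
    field_simp
    ring
  simp only [h1, Finset.sum_sub_distrib, Finset.sum_add_distrib]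
  rw [Finset.sum_comm (f := fun i j => A j i * w i / w j * v j ^ 2)]
  simp only [← Finset.sum_mul, ← Finset.sum_div, ← Finset.mul_sum]
  ring

theorem cubic {n : ℕ} (T : Fin n → Fin n → Fin n → ℝ) (hT : ∀ i j k, 0 < T i j k)
    (h12 : ∀ i j k, T i j k = T j i k) (h23 : ∀ i j k, T i j k = T i k j)
    (hR : ∀ i, RCS (Matrix.of (T i))) (w : Fin n → ℝ) (hw : ∀ i, 0 < w i) :
    RCS (Matrix.of fun j k => ∑ i, w i * T i j k) := by
  set A : Matrix (Fin n) (Fin n) ℝ := Matrix.of fun j k => ∑ i, w i * T i j k with hA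
  have hAsymm : ∀ i j, A i j = A j i := by
    intro i j; simp only [hA, Matrix.of_apply]
    exact Finset.sum_congr rfl fun k _ => by rw [h23]
  have hAH : A.IsHermitian := by
    ext i j; simp [hAsymm i j]
  rcases isEmpty_or_nonempty (Fin n) with hn | hn
  · intro u v hu; simp [dotProduct] at hu
  have hApos : ∀ i j, 0 < A i j := fun i j =>
    Finset.sum_pos (fun k _ => mul_pos (hw k) (hT _ _ _)) Finset.univ_nonempty
  have hAw : ∀ i, 0 < A.mulVec w i := fun i =>
    Finset.sum_pos (fun k _ => mul_pos (hApos _ _) (hw k)) Finset.univ_nonempty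
  set D : Fin n → ℝ := fun i => A.mulVec w i / w i with hD
  have hDpos : ∀ i, 0 < D i := fun i => div_pos (hAw i) (hw i)
  set s : Fin n → ℝ := fun i => √(D i) with hs
  have hspos : ∀ i, 0 < s i := fun i => Real.sqrt_pos.mpr (hDpos i)
  have hss : ∀ i, s i ^ 2 = D i := fun i => Real.sq_sqrt (hDpos i).le
  set S : Matrix (Fin n) (Fin n) ℝ := Matrix.of fun i j => A i j / (s i * s j) with hS
  have hSH : S.IsHermitian := by
    ext i j; simp [hS, hAsymm i j, mul_comm]
  -- relation with M_i
  have hMw : ∀ i v, w ⬝ᵥ (Matrix.of (T i)).mulVec v = A.mulVec v i := by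
    intro i v
    simp only [dotProduct, Matrix.mulVec, hA, Matrix.of_apply, Finset.mul_sum, Finset.sum_mul]
    rw [Finset.sum_comm]
    refine Finset.sum_congr rfl fun j _ => Finset.sum_congr rfl fun k _ => ?_
    rw [h12]; ring
  have hsum : ∀ v, v ⬝ᵥ A.mulVec v = ∑ i, w i * (v ⬝ᵥ (Matrix.of (T i)).mulVec v) := by
    intro v
    simp only [dotProduct, Matrix.mulVec, hA, Matrix.of_apply, Finset.mul_sum, Finset.sum_mul]
    conv_rhs => rw [Finset.sum_comm]
    refine Finset.sum_congr rfl fun j _ => ?_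
    rw [Finset.sum_comm]
    refine Finset.sum_congr rfl fun k _ => Finset.sum_congr rfl fun l _ => ?_
    ring
  have bochner : ∀ v, v ⬝ᵥ A.mulVec v ≤ ∑ i, w i * ((A.mulVec v i) ^ 2 / A.mulVec w i) := by
    intro v
    rw [hsum]
    refine Finset.sum_le_sum fun i _ => mul_le_mul_of_nonneg_left ?_ (hw i).le
    have := hR i w v (by rw [hMw]; exact hAw i)
    rw [hMw, hMw] at this
    rw [le_div_iff₀ (hAw i)]
    linarith
  -- eigenvalue analysis
  have eig : ∀ m, hSH.eigenvalues m ≤ 0 ∨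
      ∃ c : ℝ, ∀ i, (hSH.eigenvectorBasis m : Fin n → ℝ) i = s i * (c * w i) := by
    intro m
    set lam := hSH.eigenvalues m
    set e : Fin n → ℝ := ⇑(hSH.eigenvectorBasis m) with he
    have hSe : S.mulVec e = lam • e := hSH.mulVec_eigenvectorBasis m
    have hnorm : ∑ i, e i ^ 2 = 1 := by
      have h1 := hSH.eigenvectorBasis.orthonormal.1 m
      rw [EuclideanSpace.norm_eq, Real.sqrt_eq_one] at h1
      simpa using h1
    set v : Fin n → ℝ := fun i => e i / s i with hv
    have hAv : ∀ i, A.mulVec v i = lam * (D i * v i) := by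
      intro i
      have h1 : A.mulVec v i = s i * S.mulVec e i := by
        simp only [Matrix.mulVec, dotProduct, hS, hv, Matrix.of_apply, Finset.mul_sum]
        refine Finset.sum_congr rfl fun j _ => ?_
        have := (hspos i).ne'
        have := (hspos j).ne'
        field_simp
      rw [h1, hSe, ← hss]
      have := (hspos i).ne'
      simp only [hv, Pi.smul_apply, smul_eq_mul]
      field_simp
    have hDv : ∑ i, D i * v i ^ 2 = 1 := by
      rw [← hnorm]
      refine Finset.sum_congr rfl fun i _ => ?_
      have := (hspos i).ne'
      rw [← hss]; simp only [hv]; field_simp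
    have hvAv : v ⬝ᵥ A.mulVec v = lam := by
      simp only [dotProduct, hAv]
      trans lam * ∑ i, D i * v i ^ 2
      · rw [Finset.mul_sum]
        exact Finset.sum_congr rfl fun i _ => by ring
      · rw [hDv, mul_one]
    have hb := bochner v
    have hb2 : ∑ i, w i * ((A.mulVec v i) ^ 2 / A.mulVec w i) = lam ^ 2 := by
      rw [← mul_one (lam ^ 2), ← hDv, Finset.mul_sum]
      refine Finset.sum_congr rfl fun i _ => ?_
      rw [hAv]
      have := (hw i).ne'
      have := (hAw i).ne'
      simp only [hD]
      field_simp
    rw [hvAv, hb2] at hb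
    have hP := perron_ident (fun i j => A i j) hAsymm w v hw
    have hr : ∑ i, (∑ j, A i j * w j) / w i * v i ^ 2 = 1 := hDv
    have hr2 : ∑ i, v i * ∑ j, A i j * v j = lam := hvAv
    rw [hr, hr2] at hP
    by_cases hl : lam ≤ 0
    · exact Or.inl hl
    right
    push Not at hl
    have hl1 : 1 ≤ lam := by nlinarith
    have hnn : ∀ i j, 0 ≤ A i j * w i * w j * (v i / w i - v j / w j) ^ 2 := fun i j =>
      mul_nonneg (mul_nonneg (mul_nonneg (hApos i j).le (hw i).le) (hw j).le) (sq_nonneg _)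
    have hz : ∑ i, ∑ j, A i j * w i * w j * (v i / w i - v j / w j) ^ 2 = 0 :=
      le_antisymm (by rw [hP]; linarith)
        (Finset.sum_nonneg fun i _ => Finset.sum_nonneg fun j _ => hnn i j)
    obtain ⟨j0⟩ := hn
    refine ⟨v j0 / w j0, fun i => ?_⟩
    have h1 := (Finset.sum_eq_zero_iff_of_nonneg
      (fun i _ => Finset.sum_nonneg fun j _ => hnn i j)).mp hz i (Finset.mem_univ _)
    have h2 := (Finset.sum_eq_zero_iff_of_nonneg (fun j _ => hnn i j)).mp h1 j0 (Finset.mem_univ _)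
    have h3 : A i j0 * w i * w j0 ≠ 0 :=
      (mul_pos (mul_pos (hApos i j0) (hw i)) (hw j0)).ne'
    have h4 : v i / w i - v j0 / w j0 = 0 := by
      rcases mul_eq_zero.mp h2 with h | h
      · exact absurd h h3
      · exact pow_eq_zero_iff (two_ne_zero) |>.mp h
    have h5 : v j0 / w j0 = v i / w i := by linarith
    rw [h5, div_mul_cancel₀ _ (hw i).ne']
    simp only [hv]
    rw [mul_div_cancel₀ _ (hspos i).ne']
  refine RCS_of_functional hAH (A.mulVec w) fun p hp => ?_
  set q : Fin n → ℝ := fun i => s i * p i with hq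
  have h1 : p ⬝ᵥ A.mulVec p = q ⬝ᵥ S.mulVec q := by
    simp only [Matrix.mulVec, dotProduct, hS, hq, Matrix.of_apply, Finset.mul_sum]
    refine Finset.sum_congr rfl fun i _ => Finset.sum_congr rfl fun j _ => ?_
    have := (hspos i).ne'
    have := (hspos j).ne'
    field_simp
  rw [h1, spectral_sum hSH]
  refine Finset.sum_nonpos fun m _ => ?_
  rcases eig m with h | ⟨c, hc⟩
  · exact mul_nonpos_of_nonpos_of_nonneg h (sq_nonneg _)
  · have : (hSH.eigenvectorBasis m : Fin n → ℝ) ⬝ᵥ q = 0 := by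
      have h2 : (hSH.eigenvectorBasis m : Fin n → ℝ) ⬝ᵥ q = c * (A.mulVec w ⬝ᵥ p) := by
        simp only [dotProduct, Finset.mul_sum]
        refine Finset.sum_congr rfl fun i _ => ?_
        rw [hc]
        have h3 : D i * w i = A.mulVec w i := div_mul_cancel₀ _ (hw i).ne'
        rw [← h3, ← hss]; simp only [hq]; ring
      rw [h2, hp, mul_zero]
    rw [this]; simp

/-- Partial derivative as a linear endomorphism. -/
noncomputable def pdE {n : ℕ} (i : Fin n) : Module.End ℝ (MvPolynomial (Fin n) ℝ) :=
  (pderiv i : Derivation ℝ (MvPolynomial (Fin n) ℝ) (MvPolynomial (Fin n) ℝ)).toLinearMap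

@[simp] theorem pdE_apply {n : ℕ} (i : Fin n) (f : MvPolynomial (Fin n) ℝ) :
    pdE i f = pderiv i f := rfl

/-- Directional derivative. -/
noncomputable def dd {n : ℕ} (v : Fin n → ℝ) : Module.End ℝ (MvPolynomial (Fin n) ℝ) :=
  ∑ i, v i • pdE i

theorem dd_apply {n : ℕ} (v : Fin n → ℝ) (f : MvPolynomial (Fin n) ℝ) :
    dd v f = ∑ i, v i • pderiv i f := by
  simp [dd, LinearMap.sum_apply]

theorem dd_add {n : ℕ} (u v : Fin n → ℝ) : dd (u + v) = dd u + dd v := by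
  simp [dd, add_smul, Finset.sum_add_distrib]

theorem pderiv_comm' {n : ℕ} (i j : Fin n) (f : MvPolynomial (Fin n) ℝ) :
    pderiv i (pderiv j f) = pderiv j (pderiv i f) := by
  ext m
  by_cases h : i = j
  · rw [h]
  simp only [coeff_pderiv]
  have h1 : ((m + Finsupp.single i 1 : Fin n →₀ ℕ) j) = m j := by simp [h]
  have h2 : ((m + Finsupp.single j 1 : Fin n →₀ ℕ) i) = m i := by simp [Ne.symm h]
  rw [h1, h2, add_right_comm]
  ring

theorem pdE_commute {n : ℕ} (i j : Fin n) : Commute (pdE i) (pdE j) :=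
  LinearMap.ext fun f => pderiv_comm' i j f

theorem pdE_dd_commute {n : ℕ} (i : Fin n) (v : Fin n → ℝ) : Commute (pdE i) (dd v) :=
  Commute.sum_right _ _ _ fun j _ => (pdE_commute i j).smul_right _

theorem dd_commute {n : ℕ} (u v : Fin n → ℝ) : Commute (dd u) (dd v) :=
  Commute.sum_left _ _ _ fun j _ => (pdE_dd_commute j v).smul_left _

theorem PPos_pderiv {n k : ℕ} {f : MvPolynomial (Fin n) ℝ} (hf : f ∈ PPos n (k + 1)) (i : Fin n) :
    pderiv i f ∈ PPos n k := by
  refine ⟨hf.1.pderiv, fun α hα => ?_⟩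
  rw [coeff_pderiv]
  refine mul_pos (hf.2 _ ?_) (by positivity)
  simp [Finset.sum_add_distrib, hα, Finsupp.single_apply]

theorem PPos_dd {n k : ℕ} [Nonempty (Fin n)] {f : MvPolynomial (Fin n) ℝ}
    (hf : f ∈ PPos n (k + 1)) {v : Fin n → ℝ} (hv : ∀ i, 0 < v i) : dd v f ∈ PPos n k := by
  rw [dd_apply]
  refine ⟨?_, fun α hα => ?_⟩
  · refine IsHomogeneous.sum _ _ _ fun i _ => ?_
    rw [smul_eq_C_mul]
    simpa using (isHomogeneous_C _ (v i)).mul (PPos_pderiv hf i).1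
  · rw [coeff_sum]
    refine Finset.sum_pos (fun i _ => ?_) Finset.univ_nonempty
    rw [coeff_smul]
    exact mul_pos (hv i) ((PPos_pderiv hf i).2 α hα)

theorem PPos_pow {n : ℕ} [Nonempty (Fin n)] {v : Fin n → ℝ} (hv : ∀ i, 0 < v i) (m k : ℕ)
    {f : MvPolynomial (Fin n) ℝ} (hf : f ∈ PPos n (k + m)) : (dd v ^ m) f ∈ PPos n k := by
  induction m generalizing f with
  | zero => simpa using hf
  | succ m ih =>
    rw [pow_succ, Module.End.mul_apply]
    exact ih (PPos_dd hf hv)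

theorem PPos_list {n : ℕ} [Nonempty (Fin n)] (vs : List (Fin n → ℝ)) (hvs : ∀ v ∈ vs, ∀ i, 0 < v i)
    (k : ℕ) {f : MvPolynomial (Fin n) ℝ} (hf : f ∈ PPos n (k + vs.length)) :
    (vs.map dd).prod f ∈ PPos n k := by
  induction vs generalizing k with
  | nil => simpa using hf
  | cons v vs ih =>
    rw [List.map_cons, List.prod_cons, Module.End.mul_apply]
    refine PPos_dd (ih (fun v hv => hvs v (List.mem_cons_of_mem _ hv)) (k + 1) ?_)
      (hvs v List.mem_cons_self)
    rw [List.length_cons] at hf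
    rwa [add_assoc, add_comm 1]

theorem PPos_eval {n k : ℕ} [Nonempty (Fin n)] {f : MvPolynomial (Fin n) ℝ} (hf : f ∈ PPos n k)
    {x : Fin n → ℝ} (hx : ∀ i, 0 < x i) : 0 < eval x f := by
  rw [eval_eq']
  refine Finset.sum_pos (fun α hα => ?_) ?_
  · refine mul_pos (hf.2 α ?_) (Finset.prod_pos fun i _ => pow_pos (hx i) _)
    have h := hf.1 (mem_support_iff.mp hα)
    rw [← h]
    simp [Finsupp.weight_apply, Finsupp.sum_fintype]
  · obtain ⟨i⟩ := (inferInstance : Nonempty (Fin n))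
    refine ⟨Finsupp.single i k, mem_support_iff.mpr (hf.2 _ ?_).ne'⟩
    simp [Finsupp.single_apply]

theorem PPos_const {n : ℕ} {f : MvPolynomial (Fin n) ℝ} (hf : f ∈ PPos n 0) (x : Fin n → ℝ) :
    eval x f = f.coeff 0 := by
  have := hf.1.totalDegree_le
  rw [totalDegree_eq_zero_iff_eq_C.mp (Nat.le_zero.mp this)]
  simp

theorem euler_eval {n k : ℕ} {f : MvPolynomial (Fin n) ℝ} (hf : f.IsHomogeneous k)
    (x : Fin n → ℝ) : eval x (dd x f) = k * eval x f := by
  have h := congrArg (eval x) hf.sum_X_mul_pderiv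
  simp only [map_sum, map_mul, eval_X, nsmul_eq_mul, map_natCast] at h
  rw [dd_apply, ← h, map_sum]
  simp [smul_eval]

theorem eval_zero_pow {n : ℕ} [Nonempty (Fin n)] (k : ℕ) {f : MvPolynomial (Fin n) ℝ}
    (hf : f ∈ PPos n k) {x : Fin n → ℝ} (hx : ∀ i, 0 < x i) :
    eval 0 ((dd x ^ k) f) = k.factorial * eval x f := by
  induction k generalizing f with
  | zero => rw [PPos_const hf x, pow_zero, Module.End.one_apply, PPos_const hf 0]; simp
  | succ k ih =>
    rw [pow_succ, Module.End.mul_apply, ih (PPos_dd hf hx), euler_eval hf.1, Nat.factorial_succ]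
    push_cast; ring

theorem taylor {n : ℕ} [Nonempty (Fin n)] (k : ℕ) {f : MvPolynomial (Fin n) ℝ}
    (hf : f ∈ PPos n k) {x y : Fin n → ℝ} (hx : ∀ i, 0 < x i) (hy : ∀ i, 0 < y i) :
    eval (x + y) f = ∑ b ∈ Finset.range (k + 1), eval x ((dd y ^ b) f) / b.factorial := by
  have h := eval_zero_pow k hf (x := x + y) (fun i => add_pos (hx i) (hy i))
  rw [dd_add, add_comm (dd x), (dd_commute y x).add_pow] at h
  have hk : (k.factorial : ℝ) ≠ 0 := by positivity
  have h2 : (k.factorial : ℝ) * eval (x + y) f =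
      k.factorial * ∑ b ∈ Finset.range (k + 1), eval x ((dd y ^ b) f) / b.factorial := by
    rw [← h, LinearMap.sum_apply, map_sum, Finset.mul_sum]
    refine Finset.sum_congr rfl fun b hb => ?_
    have hb' : b ≤ k := Nat.lt_succ_iff.mp (Finset.mem_range.mp hb)
    have hP : (dd y ^ b) f ∈ PPos n (k - b) := PPos_pow hy b (k - b) (by
      rwa [Nat.sub_add_cancel hb'])
    have e1 : (dd y ^ b * dd x ^ (k - b) *
        ((k.choose b : ℕ) : Module.End ℝ (MvPolynomial (Fin n) ℝ)) :
          Module.End ℝ (MvPolynomial (Fin n) ℝ)) f =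
        (k.choose b : ℝ) • (dd x ^ (k - b)) ((dd y ^ b) f) := by
      rw [((dd_commute y x).pow_pow b (k - b)).eq]
      simp only [Module.End.mul_apply, Module.End.natCast_apply, map_nsmul]
      rw [← Nat.cast_smul_eq_nsmul ℝ]
    rw [e1, smul_eval, eval_zero_pow (k - b) hP hx]
    have h3 : (k.choose b : ℝ) * b.factorial * (k - b).factorial = k.factorial := by
      exact_mod_cast Nat.choose_mul_factorial_mul_factorial hb'
    rw [← h3]
    have : (b.factorial : ℝ) ≠ 0 := by positivity
    field_simp
  exact mul_left_cancel₀ hk h2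

theorem hess_form {n : ℕ} (h : MvPolynomial (Fin n) ℝ) (u v : Fin n → ℝ) :
    u ⬝ᵥ (hess h 0).mulVec v = eval 0 (dd u (dd v h)) := by
  simp only [dd_apply, dotProduct, Matrix.mulVec, hess, Matrix.of_apply, map_sum, smul_eval,
    Finset.mul_sum, Derivation.map_smul]
  rw [Finset.sum_comm]
  refine Finset.sum_congr rfl fun i _ => Finset.sum_congr rfl fun j _ => by ring

theorem main_RCS {n : ℕ} [Nonempty (Fin n)] (k : ℕ) (f : MvPolynomial (Fin n) ℝ)
    (hf : f ∈ PPos n (k + 2))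
    (hS : ∀ l : List (Fin n), l.length = k → (l.map pdE).prod f ∈ StrictLor2 n)
    (vs : List (Fin n → ℝ)) (hl : vs.length = k) (hvs : ∀ v ∈ vs, ∀ i, 0 < v i) :
    RCS (hess ((vs.map dd).prod f) 0) := by
  induction k generalizing f vs with
  | zero =>
    obtain rfl := List.length_eq_zero_iff.mp hl
    have := hS [] rfl
    simp only [List.map_nil, List.prod_nil, Module.End.one_apply] at this ⊢
    exact RCS_of_posEig this.2.2
  | succ k ih =>
    obtain ⟨w, vs, rfl⟩ := List.exists_cons_of_length_eq_add_one hl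
    rw [List.length_cons, Nat.add_right_cancel_iff] at hl
    have hw := hvs w List.mem_cons_self
    have hvs' : ∀ v ∈ vs, ∀ i, 0 < v i := fun v hv => hvs v (List.mem_cons_of_mem _ hv)
    rw [List.map_cons, List.prod_cons, Module.End.mul_apply]
    set h := (vs.map dd).prod f with hh
    have hP : h ∈ PPos n 3 := PPos_list vs hvs' 3 (by rwa [hl, show 3 + k = k + 1 + 2 by ring])
    have hi : ∀ i, RCS (hess (pderiv i h) 0) := by
      intro i
      have hc : Commute (pdE i) (vs.map dd).prod := by
        refine Commute.list_prod_right _ _ fun x hx => ?_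
        obtain ⟨v, _, rfl⟩ := List.mem_map.mp hx
        exact pdE_dd_commute i v
      have e : pderiv i h = (vs.map dd).prod (pderiv i f) := by
        have := congrArg (fun L => L f) hc.eq
        exact this
      rw [e]
      refine ih (pderiv i f) (PPos_pderiv (k := k + 2) hf i) (fun l hl' => ?_) vs hl hvs'
      have := hS (l ++ [i]) (by simp [hl'])
      simpa using this
    have key := cubic (fun i j k => eval 0 (pderiv j (pderiv k (pderiv i h)))) ?_ ?_ ?_ hi w hw
    · convert key using 1
      ext j k
      simp [hess, dd_apply]
    · intro i j k
      rw [PPos_const (PPos_pderiv (PPos_pderiv (PPos_pderiv hP i) k) j)]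
      exact (PPos_pderiv (PPos_pderiv (PPos_pderiv hP i) k) j).2 0 (by simp)
    · intro i j k
      rw [pderiv_comm' k i, pderiv_comm' j i, pderiv_comm' k j]
    · intro i j k
      rw [pderiv_comm' j k]

theorem pd_eq {n : ℕ} (α : Fin n → ℕ) (f : MvPolynomial (Fin n) ℝ) :
    pd α f = ((List.finRange n).map (fun i => pdE i ^ α i)).prod f := by
  unfold pd
  induction (List.finRange n) with
  | nil => simp
  | cons i L ih =>
    rw [List.foldr_cons, ih, List.map_cons, List.prod_cons, Module.End.mul_apply, Module.End.pow_apply]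
    rfl

theorem prod_single {n : ℕ} (α : Fin n → ℕ) (i : Fin n) (L : List (Fin n)) (hL : L.Nodup) :
    (L.map (fun j => pdE j ^ (α + Pi.single i 1 : Fin n → ℕ) j)).prod =
      (if i ∈ L then pdE i else 1) * (L.map (fun j => pdE j ^ α j)).prod := by
  induction L with
  | nil => simp
  | cons j L ih =>
    rw [List.nodup_cons] at hL
    rw [List.map_cons, List.prod_cons, ih hL.2, List.map_cons, List.prod_cons]
    by_cases hij : i = j
    · subst hij
      simp [hL.1, pow_succ', mul_assoc]
    · by_cases hi : i ∈ L
      · have : (Pi.single i 1 : Fin n → ℕ) j = 0 := by simp [Pi.single_apply, Ne.symm hij]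
        simp only [hi, List.mem_cons, or_true, if_true, Pi.add_apply, this, add_zero]
        rw [← mul_assoc, ← mul_assoc, ((pdE_commute i j).pow_right (α j)).eq]
      · have : (Pi.single i 1 : Fin n → ℕ) j = 0 := by simp [Pi.single_apply, Ne.symm hij]
        simp [hi, hij, this]

theorem list_pd {n : ℕ} (f : MvPolynomial (Fin n) ℝ) (l : List (Fin n)) :
    ∃ α : Fin n → ℕ, (∑ i, α i) = l.length ∧ (l.map pdE).prod f = pd α f := by
  induction l with
  | nil => exact ⟨0, by simp, by simp [pd_eq]⟩
  | cons i l ih =>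
    obtain ⟨α, h1, h2⟩ := ih
    refine ⟨α + Pi.single i 1, by simp [Finset.sum_add_distrib, h1], ?_⟩
    rw [List.map_cons, List.prod_cons, Module.End.mul_apply, h2, pd_eq, pd_eq,
      prod_single _ _ _ (List.nodup_finRange n)]
    simp

theorem hess_symm {n : ℕ} (h : MvPolynomial (Fin n) ℝ) (x : Fin n → ℝ) :
    (hess h x).IsHermitian := by
  ext i j
  simp [hess, pderiv_comm' i j]

theorem rayleigh_mat {n : ℕ} {M : Matrix (Fin n) (Fin n) ℝ} (hM : M.IsHermitian) (hR : RCS M)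
    (x y z : Fin n → ℝ) (hxx : 0 < x ⬝ᵥ M.mulVec x) (hxy : 0 < x ⬝ᵥ M.mulVec y)
    (hxz : 0 < x ⬝ᵥ M.mulVec z) (hyy : 0 ≤ y ⬝ᵥ M.mulVec y) (hzz : 0 ≤ z ⬝ᵥ M.mulVec z) :
    (x ⬝ᵥ M.mulVec x) * (y ⬝ᵥ M.mulVec z) ≤ 2 * (x ⬝ᵥ M.mulVec y) * (x ⬝ᵥ M.mulVec z) := by
  have h := hR x ((x ⬝ᵥ M.mulVec z) • y + (x ⬝ᵥ M.mulVec y) • z) hxx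
  have hzy : z ⬝ᵥ M.mulVec y = y ⬝ᵥ M.mulVec z := by
    rw [symm_dot hM z y, dotProduct_comm]
  simp only [Matrix.mulVec_add, Matrix.mulVec_smul, dotProduct_add, add_dotProduct, dotProduct_smul,
    smul_dotProduct, smul_eq_mul, hzy] at h
  set A := x ⬝ᵥ M.mulVec x
  set a := x ⬝ᵥ M.mulVec y
  set c := x ⬝ᵥ M.mulVec z
  set Y := y ⬝ᵥ M.mulVec y
  set Z := z ⬝ᵥ M.mulVec z
  set B := y ⬝ᵥ M.mulVec z
  have h1 : 0 ≤ A * (c ^ 2 * Y) := by positivity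
  have h2 : 0 ≤ A * (a ^ 2 * Z) := by positivity
  have h3 : (2 * (a * c)) * (A * B) ≤ (2 * (a * c)) * (2 * a * c) := by nlinarith
  exact le_of_mul_le_mul_left h3 (by positivity)

theorem step_ineq {n d : ℕ} [Nonempty (Fin n)] {f : MvPolynomial (Fin n) ℝ} (hf : f ∈ PPos n d)
    (hS : ∀ l : List (Fin n), l.length + 2 = d → (l.map pdE).prod f ∈ StrictLor2 n)
    {x y z : Fin n → ℝ} (hx : ∀ i, 0 < x i) (hy : ∀ i, 0 < y i) (hz : ∀ i, 0 < z i)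
    (b g k : ℕ) (hd : k + 2 + b + g = d) :
    eval x ((dd y ^ b) ((dd z ^ g) f)) * eval x ((dd y ^ (b + 1)) ((dd z ^ (g + 1)) f)) * (k + 2 : ℝ)
      ≤ 2 * (k + 1 : ℝ) * eval x ((dd y ^ (b + 1)) ((dd z ^ g) f)) *
        eval x ((dd y ^ b) ((dd z ^ (g + 1)) f)) := by
  subst hd
  set G := (dd y ^ b) ((dd z ^ g) f) with hG
  have hGP : G ∈ PPos n (k + 2) := PPos_pow hy _ _ (PPos_pow hz _ _ hf)
  have hR : RCS (hess ((dd x ^ k) G) 0) := by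
    have := main_RCS (k + b + g) f (by rwa [show k + b + g + 2 = k + 2 + b + g by ring])
      (fun l hl => hS l (by rw [hl]; ring))
      (List.replicate k x ++ List.replicate b y ++ List.replicate g z) (by simp; ring) (by
        intro v hv
        simp only [List.mem_append, List.mem_replicate] at hv
        rcases hv with (⟨_, rfl⟩ | ⟨_, rfl⟩) | ⟨_, rfl⟩ <;> assumption)
    simpa [Module.End.mul_apply] using this
  have e1 : eval x ((dd y ^ (b + 1)) ((dd z ^ g) f)) = eval x (dd y G) := by
    rw [pow_succ', Module.End.mul_apply]
  have ez : dd z G = (dd y ^ b) ((dd z ^ (g + 1)) f) := by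
    have := congrArg (fun L => L ((dd z ^ g) f)) ((dd_commute z y).pow_right b).eq
    rw [pow_succ' (dd z)]
    exact this
  have e2 : (dd y ^ (b + 1)) ((dd z ^ (g + 1)) f) = dd y (dd z G) := by
    rw [ez, pow_succ' (dd y), Module.End.mul_apply]
  rw [e1, e2, ← ez]
  have comm : ∀ (v : Fin n → ℝ) (m : ℕ) h, dd v ((dd x ^ m) h) = (dd x ^ m) (dd v h) := by
    intro v m h
    exact congrArg (fun L => L h) ((dd_commute v x).pow_right m).eq
  have q2 : ∀ v : Fin n → ℝ, (∀ i, 0 < v i) →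
      x ⬝ᵥ (hess ((dd x ^ k) G) 0).mulVec v = (k + 1).factorial * eval x (dd v G) := by
    intro v hv
    rw [hess_form, comm v, ← eval_zero_pow (k + 1) (PPos_dd hGP hv) hx, pow_succ',
      Module.End.mul_apply]
  have q3 : ∀ u v : Fin n → ℝ, (∀ i, 0 < u i) → (∀ i, 0 < v i) →
      u ⬝ᵥ (hess ((dd x ^ k) G) 0).mulVec v = k.factorial * eval x (dd u (dd v G)) := by
    intro u v hu hv
    rw [hess_form, comm v, comm u, ← eval_zero_pow k (PPos_dd (PPos_dd hGP hv) hu) hx]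
  have q1 : x ⬝ᵥ (hess ((dd x ^ k) G) 0).mulVec x = (k + 1).factorial * ((k + 2) * eval x G) := by
    rw [q2 x hx, euler_eval hGP.1]; push_cast; ring
  have p0 := PPos_eval hGP hx
  have p1 : ∀ v : Fin n → ℝ, (∀ i, 0 < v i) → 0 < eval x (dd v G) :=
    fun v hv => PPos_eval (PPos_dd hGP hv) hx
  have p2 : ∀ v : Fin n → ℝ, (∀ i, 0 < v i) → 0 < eval x (dd v (dd v G)) :=
    fun v hv => PPos_eval (PPos_dd (PPos_dd hGP hv) hv) hx
  have key := rayleigh_mat (hess_symm _ _) hR x y z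
    (by rw [q1]; positivity) (by rw [q2 y hy]; have := p1 y hy; positivity)
    (by rw [q2 z hz]; have := p1 z hz; positivity)
    (by rw [q3 y y hy hy]; have := p2 y hy; positivity)
    (by rw [q3 z z hz hz]; have := p2 z hz; positivity)
  rw [q1, q2 y hy, q2 z hz, q3 y z hy hz, Nat.factorial_succ] at key
  push_cast at key
  have hk : (0 : ℝ) < (k + 1) * k.factorial * k.factorial := by positivity
  refine le_of_mul_le_mul_left ?_ hk
  linarith

theorem ratio_aux (d : ℕ) (h : ℕ → ℕ → ℝ) (hp : ∀ b g, b + g ≤ d → 0 < h b g)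
    (hs : ∀ b g k : ℕ, k + 2 + b + g = d → h b g * h (b + 1) (g + 1) * (k + 2 : ℝ) ≤
      2 * (k + 1 : ℝ) * h (b + 1) g * h b (g + 1)) (b g m : ℕ) (hd : m + 1 + b + g = d) :
    h b 0 * h (b + 1) g * (m + 1 + g : ℝ) ≤ 2 ^ g * (m + 1 : ℝ) * (h (b + 1) 0 * h b g) := by
  induction g generalizing m with
  | zero => simp; linarith
  | succ g ih =>
    have i1 := ih (m + 1) (by omega)
    have i2 := hs b g m (by omega)
    push_cast at i1 ⊢
    have a1 := hp b 0 (by omega)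
    have a2 := hp (b + 1) (g + 1) (by omega)
    have a3 := hp b g (by omega)
    have a4 := hp (b + 1) g (by omega)
    have a5 := hp (b + 1) 0 (by omega)
    have a6 := hp b (g + 1) (by omega)
    have i3 := mul_le_mul i1 i2 (by positivity) (by positivity)
    have hk : 0 < h b g * h (b + 1) g * (m + 2 : ℝ) := by positivity
    refine le_of_mul_le_mul_left ?_ hk
    rw [pow_succ]
    linarith

theorem ratio (d : ℕ) (h : ℕ → ℕ → ℝ) (hp : ∀ b g, b + g ≤ d → 0 < h b g)
    (hs : ∀ b g k : ℕ, k + 2 + b + g = d → h b g * h (b + 1) (g + 1) * (k + 2 : ℝ) ≤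
      2 * (k + 1 : ℝ) * h (b + 1) g * h b (g + 1)) (b g m : ℕ) (hd : m + b + g = d) :
    h 0 0 * h b g * (d.factorial * m.factorial) ≤
      2 ^ (b * g) * ((m + g).factorial * (m + b).factorial) * (h b 0 * h 0 g) := by
  induction b generalizing m with
  | zero =>
    have : m + g = d := by omega
    rw [this]; simp; apply le_of_eq; ring
  | succ b ih =>
    have i1 := ih (m + 1) (by omega)
    have i2 := ratio_aux d h hp hs b g m (by omega)
    have e1 : m + 1 + b = m + (b + 1) := by ring
    have e2 : m + 1 + g = (m + g) + 1 := by ring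
    rw [e1, e2, Nat.factorial_succ, Nat.factorial_succ] at i1
    push_cast at i1
    have a1 := hp 0 0 (by omega)
    have a2 := hp (b + 1) g (by omega)
    have a3 := hp b g (by omega)
    have a4 := hp b 0 (by omega)
    have a5 := hp (b + 1) 0 (by omega)
    have a6 := hp 0 g (by omega)
    have i3 := mul_le_mul i1 i2 (by positivity) (by positivity)
    have hk : 0 < h b g * h b 0 * (m + 1 : ℝ) * (m + g + 1) := by positivity
    refine le_of_mul_le_mul_left ?_ hk
    have e3 : (2 : ℝ) ^ ((b + 1) * g) = 2 ^ (b * g) * 2 ^ g := by rw [← pow_add]; congr 1; ring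
    rw [e3]
    linarith

theorem cD_ge {d b g : ℕ} (h : b + g ≤ d) :
    2 ^ (b * g) * (((d - b).factorial * (d - g).factorial : ℕ) : ℝ) /
      ((d.factorial * (d - b - g).factorial : ℕ) : ℝ) ≤ cD d := by
  unfold cD
  exact Finset.le_sup' (fun p : ℕ × ℕ => 2 ^ (p.1 * p.2) *
      (((d - p.1).factorial * (d - p.2).factorial : ℕ) : ℝ) /
      ((d.factorial * (d - p.1 - p.2).factorial : ℕ) : ℝ)) (b := (b, g))
    (by simp only [Finset.mem_filter, Finset.mem_product, Finset.mem_range]; omega)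

theorem cD_one_le (d : ℕ) : 1 ≤ cD d := by
  have h := cD_ge (d := d) (b := 0) (g := 0) (by omega)
  have h0 : ((d.factorial * d.factorial : ℕ) : ℝ) ≠ 0 := by positivity
  simpa [h0, Nat.factorial_ne_zero] using h

theorem strict_pos {n d : ℕ} [Nonempty (Fin n)] {f : MvPolynomial (Fin n) ℝ}
    (hf : f ∈ StrictLor n d) {x y z : Fin n → ℝ} (hx : ∀ i, 0 < x i) (hy : ∀ i, 0 < y i)
    (hz : ∀ i, 0 < z i) :
    eval x f * eval (x + y + z) f ≤ cD d * (eval (x + y) f * eval (x + z) f) := by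
  have hP : f ∈ PPos n d := by
    unfold StrictLor at hf
    split_ifs at hf
    · exact hf
    · exact hf.1
  have hS : ∀ l : List (Fin n), l.length + 2 = d → (l.map pdE).prod f ∈ StrictLor2 n := by
    intro l hl
    unfold StrictLor at hf
    rw [if_neg (by omega)] at hf
    obtain ⟨α, h1, h2⟩ := list_pd f l
    rw [h2]
    exact hf.2 α (by omega)
  set h : ℕ → ℕ → ℝ := fun b g => eval x ((dd y ^ b) ((dd z ^ g) f)) with hh
  have hp : ∀ b g, b + g ≤ d → 0 < h b g := by
    intro b g hbg
    refine PPos_eval (k := d - b - g) (PPos_pow hy b _ (PPos_pow hz g _ ?_)) hx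
    rwa [show d - b - g + b + g = d by omega]
  have hr : ∀ b g, b + g ≤ d → h 0 0 * h b g ≤ cD d * (h b 0 * h 0 g) := by
    intro b g hbg
    obtain ⟨m, hm⟩ : ∃ m, m + b + g = d := ⟨d - b - g, by omega⟩
    have h1 := ratio d h hp (fun b g k hk => step_ineq hP hS hx hy hz b g k hk) b g m hm
    have h2 := cD_ge hbg
    rw [show d - b = m + g by omega, show d - g = m + b by omega, show m + g - g = m by omega] at h2
    have a1 := hp b 0 (by omega)
    have a2 := hp 0 g (by omega)
    refine le_trans ?_ (mul_le_mul_of_nonneg_right h2 (by positivity))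
    rw [div_mul_eq_mul_div, le_div_iff₀ (by positivity)]
    push_cast
    exact h1
  have t0 : eval x f = h 0 0 := by simp [hh]
  have t1 : eval (x + y) f = ∑ b ∈ Finset.range (d + 1), h b 0 / b.factorial := by
    rw [taylor d hP hx hy]; simp [hh]
  have t2 : eval (x + z) f = ∑ g ∈ Finset.range (d + 1), h 0 g / g.factorial := by
    rw [taylor d hP hx hz]; simp [hh]
  have t3 : eval (x + y + z) f = ∑ g ∈ Finset.range (d + 1),
      (∑ b ∈ Finset.range (d - g + 1), h b g / b.factorial) / g.factorial := by
    rw [taylor d hP (x := x + y) (fun i => add_pos (hx i) (hy i)) hz]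
    refine Finset.sum_congr rfl fun g hg => ?_
    have hg' : g ≤ d := Nat.lt_succ_iff.mp (Finset.mem_range.mp hg)
    rw [taylor (d - g) (PPos_pow hz g (d - g) (by rwa [Nat.sub_add_cancel hg'])) hx hy]
  have hc : 0 ≤ cD d := zero_le_one.trans (cD_one_le d)
  rw [t0, t1, t2, t3, Finset.mul_sum, Finset.mul_sum, Finset.mul_sum]
  refine Finset.sum_le_sum fun g hg => ?_
  have hg' : g ≤ d := Nat.lt_succ_iff.mp (Finset.mem_range.mp hg)
  have a2 := hp 0 g (by omega)
  calc h 0 0 * ((∑ b ∈ Finset.range (d - g + 1), h b g / b.factorial) / g.factorial)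
      = ∑ b ∈ Finset.range (d - g + 1), (h 0 0 * h b g) / b.factorial / g.factorial := by
        rw [Finset.sum_div, Finset.mul_sum]
        exact Finset.sum_congr rfl fun b _ => by ring
    _ ≤ ∑ b ∈ Finset.range (d - g + 1), (cD d * (h b 0 * h 0 g)) / b.factorial / g.factorial := by
        refine Finset.sum_le_sum fun b hb => ?_
        have hb' := Finset.mem_range.mp hb
        have := hr b g (by omega)
        gcongr
    _ ≤ ∑ b ∈ Finset.range (d + 1), (cD d * (h b 0 * h 0 g)) / b.factorial / g.factorial := by
        refine Finset.sum_le_sum_of_subset_of_nonneg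
          (Finset.range_subset_range.mpr (by omega)) fun b hb _ => ?_
        have hb' := Finset.mem_range.mp hb
        have := hp b 0 (by omega)
        positivity
    _ = cD d * ((∑ b ∈ Finset.range (d + 1), h b 0 / b.factorial) * (h 0 g / g.factorial)) := by
        rw [Finset.sum_mul, Finset.mul_sum]
        exact Finset.sum_congr rfl fun b _ => by ring

theorem strict_nonneg {n d : ℕ} {f : MvPolynomial (Fin n) ℝ}
    (hf : f ∈ StrictLor n d) {x y z : Fin n → ℝ} (hx : ∀ i, 0 ≤ x i) (hy : ∀ i, 0 ≤ y i)
    (hz : ∀ i, 0 ≤ z i) :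
    eval x f * eval (x + y + z) f ≤ cD d * (eval (x + y) f * eval (x + z) f) := by
  rcases isEmpty_or_nonempty (Fin n) with hn | hn
  · have e : ∀ u : Fin n → ℝ, u = x := fun u => Subsingleton.elim _ _
    rw [e (x + y + z), e (x + y), e (x + z)]
    nlinarith [cD_one_le d, mul_self_nonneg (eval x f)]
  let one : Fin n → ℝ := fun _ => 1
  have hcont : ∀ u : Fin n → ℝ → ℝ, (∀ i, Continuous (u i)) →
      Continuous fun t : ℝ => eval (fun i => u i t) f := by
    intro u hu
    exact (MvPolynomial.continuous_eval f).comp (continuous_pi hu)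
  let L : ℝ → ℝ := fun t => eval (fun i => x i + t) f * eval (fun i => (x i + t) + (y i + t) + (z i + t)) f
  let R : ℝ → ℝ := fun t => cD d * (eval (fun i => (x i + t) + (y i + t)) f *
    eval (fun i => (x i + t) + (z i + t)) f)
  have hL : Continuous L :=
    (hcont (fun i t => x i + t) (fun i => by fun_prop)).mul
      (hcont (fun i t => (x i + t) + (y i + t) + (z i + t)) (fun i => by fun_prop))
  have hR : Continuous R :=
    continuous_const.mul ((hcont (fun i t => (x i + t) + (y i + t)) (fun i => by fun_prop)).mul
      (hcont (fun i t => (x i + t) + (z i + t)) (fun i => by fun_prop)))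
  have hle : L 0 ≤ R 0 := by
    refine le_of_tendsto_of_tendsto (b := nhdsWithin (0 : ℝ) (Set.Ioi 0))
      (hL.tendsto 0 |>.mono_left nhdsWithin_le_nhds)
      (hR.tendsto 0 |>.mono_left nhdsWithin_le_nhds) ?_
    filter_upwards [self_mem_nhdsWithin] with t ht
    exact strict_pos hf (x := fun i => x i + t) (y := fun i => y i + t) (z := fun i => z i + t)
      (fun i => add_pos_of_nonneg_of_pos (hx i) ht) (fun i => add_pos_of_nonneg_of_pos (hy i) ht)
      (fun i => add_pos_of_nonneg_of_pos (hz i) ht)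
  simp only [L, R, add_zero] at hle
  exact hle

theorem eval_coeff {n d : ℕ} {f : MvPolynomial (Fin n) ℝ} (hf : f.IsHomogeneous d)
    (x : Fin n → ℝ) : eval x f =
      ∑ α ∈ Finset.finsuppAntidiag Finset.univ d, coeffFun f α * ∏ i, x i ^ α i := by
  rw [eval_eq']
  refine Finset.sum_subset (fun α hα => ?_) (fun α _ hα => ?_)
  · have h := hf (mem_support_iff.mp hα)
    rw [Finset.mem_finsuppAntidiag]
    refine ⟨?_, Finset.subset_univ _⟩
    rw [← h]
    simp [Finsupp.weight_apply, Finsupp.sum_fintype]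
  · rw [notMem_support_iff.mp hα, zero_mul]

/-- Plünnecke–Ruzsa inequality for Lorentzian polynomials:
`f(x)·f(x+y+z) ≤ c_d · f(x+y)·f(x+z)` for all nonnegative `x, y, z`. -/
theorem statement4 {n d : ℕ} (f : MvPolynomial (Fin n) ℝ) (hf : f ∈ Lor n d)
    (x y z : Fin n → ℝ) (hx : ∀ i, 0 ≤ x i) (hy : ∀ i, 0 ≤ y i) (hz : ∀ i, 0 ≤ z i) :
    eval x f * eval (x + y + z) f ≤ cD d * (eval (x + y) f * eval (x + z) f) := by
  obtain ⟨hh, hcl⟩ := hf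
  let E : (Fin n → ℝ) → ((Fin n →₀ ℕ) → ℝ) → ℝ := fun u c =>
    ∑ α ∈ Finset.finsuppAntidiag Finset.univ d, c α * ∏ i, u i ^ α i
  have hE : ∀ u, Continuous (E u) := fun u =>
    continuous_finsetSum _ fun α _ => (continuous_apply α).mul continuous_const
  have hclosed : IsClosed {c | E x c * E (x + y + z) c ≤ cD d * (E (x + y) c * E (x + z) c)} :=
    isClosed_le ((hE _).mul (hE _)) (continuous_const.mul ((hE _).mul (hE _)))
  have hsub : coeffFun '' StrictLor n d ⊆
      {c | E x c * E (x + y + z) c ≤ cD d * (E (x + y) c * E (x + z) c)} := by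
    rintro _ ⟨g, hg, rfl⟩
    have hP : g.IsHomogeneous d := by
      unfold StrictLor at hg
      split_ifs at hg
      · exact hg.1
      · exact hg.1.1
    have h := strict_nonneg hg hx hy hz
    simp only [eval_coeff hP] at h
    exact h
  have h := closure_minimal hsub hclosed hcl
  simp only [eval_coeff hh]
  exact h

end LorentzianPaper
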